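/- In a good observation scheme, for the linear-form recovery problem define Opt_{ij}(K) = inf{ ½[Ψ_{i,+}(α,φ) + Ψ_{j,−}(α,φ)] : α > 0, φ ∈ F } and Opt(K) = max_{1≤i,j≤I} Opt_{ij}(K), and let Risk*_ε(K) be the minimax ε-risk over all Borel estimates using K-repeated observations. Then for every ε ∈ (0,1/2), every positive integer K̄, and every integer K > 2 ln(2I/ε) K̄ / ln(1/(4ε(1−ε))), one has Opt(K) ≤ Risk*_ε(K̄). -/

import Mathlib

open MeasureTheory

/-- A *good observation scheme* `((Ω,P), {p_μ : μ ∈ M}, F)` in the sense of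
Goldenshluger–Juditsky–Nemirovski: `Ω` is a Polish space carrying a σ-finite Borel
measure `P` of full support, `M ⊆ ℝ^m` is a convex relatively open set, each `p_μ`
(`μ ∈ M`) is a positive probability density w.r.t. `P`, jointly continuous in `(μ,ω)`,
and `F` is a finite-dimensional space of continuous functions containing the constants
and all log-likelihood ratios, on which the function
`Φ(φ;μ) = ln ∫ e^{φ} p_μ dP` is real-valued and concave in `μ`. -/
structure GoodOS (Ω : Type) [TopologicalSpace Ω] [PolishSpace Ω] [MeasurableSpace Ω]
    [BorelSpace Ω] (m : ℕ) where
  P : Measure Ω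
  sigmaFinite : SigmaFinite P
  full_support : ∀ U : Set Ω, IsOpen U → U.Nonempty → 0 < P U
  M : Set (Fin m → ℝ)
  M_convex : Convex ℝ M
  M_relatively_open : IsOpen (Subtype.val ⁻¹' M : Set (affineSpan ℝ M))
  p : (Fin m → ℝ) → Ω → ℝ
  p_pos : ∀ μ ∈ M, ∀ ω : Ω, 0 < p μ ω
  p_cont : ContinuousOn (fun q : (Fin m → ℝ) × Ω => p q.1 q.2) (M ×ˢ Set.univ)
  p_prob : ∀ μ ∈ M, ∫ ω, p μ ω ∂P = 1
  F : Submodule ℝ (Ω → ℝ)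
  F_finiteDimensional : FiniteDimensional ℝ F
  F_cont : ∀ φ ∈ F, Continuous φ
  F_const : ∀ c : ℝ, (fun _ : Ω => c) ∈ F
  F_logratio : ∀ μ ∈ M, ∀ ν ∈ M, (fun ω => Real.log (p μ ω / p ν ω)) ∈ F
  mgf_integrable : ∀ φ ∈ F, ∀ μ ∈ M,
    Integrable (fun ω => Real.exp (φ ω) * p μ ω) P
  mgf_pos : ∀ φ ∈ F, ∀ μ ∈ M, 0 < ∫ ω, Real.exp (φ ω) * p μ ω ∂P
  mgf_concave : ∀ φ ∈ F,
    ConcaveOn ℝ M fun μ => Real.log (∫ ω, Real.exp (φ ω) * p μ ω ∂P)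

/-- The distribution of `K` i.i.d. observations drawn from the distribution with density
`f` w.r.t. `P`. -/
noncomputable def prodDensityMeasure {Ω : Type*} [MeasurableSpace Ω] (P : Measure Ω)
    (K : ℕ) (f : Ω → ℝ) : Measure (Fin K → Ω) :=
  (Measure.pi fun _ : Fin K => P).withDensity fun y => ENNReal.ofReal (∏ k, f (y k))

/-- `Φ_O(φ;μ) = ln ∫ e^{φ} p_μ dP`. -/
noncomputable def GoodOS.Phi {Ω : Type} [TopologicalSpace Ω] [PolishSpace Ω]
    [MeasurableSpace Ω] [BorelSpace Ω] {m : ℕ} (O : GoodOS Ω m)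
    (φ : Ω → ℝ) (μ : Fin m → ℝ) : ℝ :=
  Real.log (∫ ω, Real.exp (φ ω) * O.p μ ω ∂O.P)

section LinearProblem

variable {Ω : Type} [TopologicalSpace Ω] [PolishSpace Ω] [MeasurableSpace Ω]
  [BorelSpace Ω] {m n : ℕ} {ι : Type} [Fintype ι] [Nonempty ι]
  (O : GoodOS Ω m) (X : ι → Set (Fin n → ℝ))
  (A : ι → (Fin n → ℝ) →ᵃ[ℝ] (Fin m → ℝ)) (g : Fin n → ℝ) (ε : ℝ) (K : ℕ)

/-- `Ψ_{ℓ,+}(β,ψ) = max_{x ∈ X_ℓ} [KβΦ(ψ/β; A_ℓ(x)) − gᵀx + β ln(2I/ε)]`. -/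
noncomputable def PsiPlus (ℓ : ι) (β : ℝ) (ψ : Ω → ℝ) : ℝ :=
  sSup {v | ∃ x ∈ X ℓ, v = (K : ℝ) * β * O.Phi (fun ω => ψ ω / β) (A ℓ x)
    - (∑ i, g i * x i) + β * Real.log (2 * (Fintype.card ι : ℝ) / ε)}

/-- `Ψ_{ℓ,−}(β,ψ) = max_{x ∈ X_ℓ} [KβΦ(−ψ/β; A_ℓ(x)) + gᵀx + β ln(2I/ε)]`. -/
noncomputable def PsiMinus (ℓ : ι) (β : ℝ) (ψ : Ω → ℝ) : ℝ :=
  sSup {v | ∃ x ∈ X ℓ, v = (K : ℝ) * β * O.Phi (fun ω => -ψ ω / β) (A ℓ x)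
    + (∑ i, g i * x i) + β * Real.log (2 * (Fintype.card ι : ℝ) / ε)}

/-- `Opt_{ij}(K) = inf {½[Ψ_{i,+}(α,φ) + Ψ_{j,−}(α,φ)] : α > 0, φ ∈ F}`. -/
noncomputable def OptIJ (i j : ι) : ℝ :=
  sInf {v | ∃ α : ℝ, 0 < α ∧ ∃ φ ∈ O.F,
    v = (1 / 2) * (PsiPlus O X A g ε K i α φ + PsiMinus O X A g ε K j α φ)}

/-- `Opt(K) = max_{i,j} Opt_{ij}(K)`. -/
noncomputable def OptTotal : ℝ :=
  Finset.univ.sup' Finset.univ_nonempty fun q : ι × ι => OptIJ O X A g ε K q.1 q.2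

/-- The minimax `ε`-risk `Risk*_ε(K̄)`: the infimum, over Borel estimates `ĝ` based on
`K̄` i.i.d. observations, of the worst-case `(ρ,ε)`-reliability level. -/
noncomputable def RiskStar (Kb : ℕ) : ℝ :=
  sInf {ρ : ℝ | ∃ ghat : (Fin Kb → Ω) → ℝ, Measurable ghat ∧
    ∀ j : ι, ∀ x ∈ X j,
      prodDensityMeasure O.P Kb (O.p (A j x))
        {y | ρ < |ghat y - ∑ i, g i * x i|} ≤ ENNReal.ofReal ε}

end LinearProblem

/-- Kneser-type minimax over a compact convex set: if every point of `X` is beaten by some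
concave continuous `f j`, then one convex combination of finitely many `f j` beats all of them. -/
theorem exists_convexCombination_lt {E J : Type*} [TopologicalSpace E] [AddCommGroup E]
    [Module ℝ E] [IsTopologicalAddGroup E] [ContinuousSMul ℝ E] {X : Set E}
    (hne : X.Nonempty) (hcomp : IsCompact X) (hconv : Convex ℝ X) (f : J → E → ℝ) (c : ℝ)
    (hconc : ∀ j, ConcaveOn ℝ X (f j)) (hcont : ∀ j, ContinuousOn (f j) X)
    (hlt : ∀ x ∈ X, ∃ j, f j x < c) :
    ∃ (s : Finset J) (w : s → ℝ), (∀ j, 0 ≤ w j) ∧ ∑ j, w j = 1 ∧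
      ∀ x ∈ X, ∑ j, w j * f j x < c := by
  classical
  obtain ⟨s, hs⟩ : ∃ s : Finset J, ∀ x ∈ X, ∃ j ∈ s, f j x < c := by
    have hnhds : ∀ x ∈ X, ∃ j, {y | f j y < c} ∈ nhdsWithin x X := fun x hx => by
      obtain ⟨j, hj⟩ := hlt x hx
      exact ⟨j, (hcont j x hx).eventually_lt_const hj⟩
    have : Nonempty J := hne.elim fun x hx => ⟨(hlt x hx).choose⟩
    choose! j hj using hnhds
    obtain ⟨t, -, ht⟩ := hcomp.elim_nhdsWithin_subcover (fun x => {y | f (j x) y < c}) hj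
    refine ⟨t.image j, fun x hx => ?_⟩
    have := ht hx
    simp only [Set.mem_iUnion] at this
    obtain ⟨y, hy, h⟩ := this
    exact ⟨j y, Finset.mem_image_of_mem _ hy, h⟩
  have hconcsum (w : s → ℝ) (hw : w ∈ stdSimplex ℝ s) :
      ConvexOn ℝ X fun x => ∑ j, w j * (-f j x) :=
    ⟨hconv, fun x hx y hy a b ha hb hab => by
      simp only [smul_eq_mul, Finset.mul_sum, ← Finset.sum_add_distrib]
      refine Finset.sum_le_sum fun j _ => ?_
      have := mul_le_mul_of_nonneg_left ((hconc j).2 hx hy ha hb hab) (hw.1 j)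
      simp only [smul_eq_mul] at this
      linarith⟩
  obtain ⟨w, hw, hwlt⟩ := Sion.exists_lt_iInf_of_lt_iInf_of_finite (X := X)
    (Y := stdSimplex ℝ s) (f := fun x w => ∑ j, w j * (-f j x)) hne hcomp
    (fun w _ => ContinuousOn.lowerSemicontinuousOn <| continuousOn_finsetSum _ fun j _ =>
      continuousOn_const.mul (hcont j).neg)
    (fun w hw => (hconcsum w hw).quasiconvexOn) (convex_stdSimplex ℝ s)
    (fun x _ => Continuous.upperSemicontinuous (by fun_prop) |>.upperSemicontinuousOn _)
    (fun x _ => by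
      refine ConcaveOn.quasiconcaveOn ⟨convex_stdSimplex ℝ s, fun u _ v _ a b _ _ _ => ?_⟩
      simp only [smul_eq_mul, Finset.mul_sum, ← Finset.sum_add_distrib]
      refine Finset.sum_le_sum fun j _ => ?_
      simp only [Pi.add_apply, Pi.smul_apply, smul_eq_mul]
      linarith)
    hconv (s := Set.range fun j : s => Pi.single j (1 : ℝ)) (Set.finite_range _)
    (by rintro _ ⟨j, rfl⟩; exact single_mem_stdSimplex ℝ j) (t := -c)
    (fun x hx => by
      obtain ⟨j, hj, h⟩ := hs x hx
      refine ⟨_, ⟨⟨j, hj⟩, rfl⟩, ?_⟩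
      simpa [Pi.single_apply] using h)
  refine ⟨s, w, hw.1, hw.2, fun x hx => ?_⟩
  have := hwlt x hx
  simp only [mul_neg, Finset.sum_neg_distrib] at this
  linarith

theorem ConcaveOn.continuousOn_of_relativelyOpen {E : Type*} [NormedAddCommGroup E]
    [NormedSpace ℝ E] [FiniteDimensional ℝ E] {M : Set E}
    (hM : IsOpen (Subtype.val ⁻¹' M : Set (affineSpan ℝ M))) {f : E → ℝ}
    (hf : ConcaveOn ℝ M f) : ContinuousOn f M := by
  rcases M.eq_empty_or_nonempty with rfl | ⟨x₀, hx₀⟩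
  · exact continuousOn_empty f
  obtain ⟨r, hr⟩ := (vectorSpan ℝ M).subtype.exists_leftInverse_of_injective
    (Submodule.ker_subtype _)
  have hx₀' : x₀ ∈ affineSpan ℝ M := subset_affineSpan ℝ M hx₀
  let π : E →ᵃ[ℝ] E :=
    ((vectorSpan ℝ M).subtype ∘ₗ r).toAffineMap.comp (AffineMap.id ℝ E - AffineMap.const ℝ E x₀)
      + AffineMap.const ℝ E x₀
  have hπ (z : E) : π z = (r (z - x₀) : E) + x₀ := by simp [π]
  have hπmem (z : E) : π z ∈ affineSpan ℝ M := by
    rw [hπ]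
    exact AffineSubspace.vadd_mem_of_mem_direction
      (by rw [direction_affineSpan]; exact (r (z - x₀)).2) hx₀'
  have hπid (z : E) (hz : z ∈ M) : π z = z := by
    have hv : z - x₀ ∈ vectorSpan ℝ M := vsub_mem_vectorSpan ℝ hz hx₀
    have := LinearMap.congr_fun hr ⟨z - x₀, hv⟩
    simp only [LinearMap.comp_apply, Submodule.subtype_apply, LinearMap.id_apply] at this
    simp [hπ, this]
  have hcont : Continuous π := π.continuous_of_finiteDimensional
  have hopen : IsOpen (π ⁻¹' M) :=
    hM.preimage (hcont.subtype_mk hπmem)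
  have := (hf.comp_affineMap π).continuousOn hopen
  exact (this.mono fun z hz => by simpa [hπid z hz] using hz).congr
    fun z hz => by simp [hπid z hz]

/-- If some event has probability at most `ε` under the density `f₁` and its complement has
probability at most `ε` under `f₂`, the Hellinger affinity of the densities is at most
`2√(ε(1-ε))`. -/
theorem integral_sqrt_mul_le_of_test {Y : Type*} [MeasurableSpace Y] {Q : Measure Y}
    {f₁ f₂ : Y → ℝ} (h₁ : ∀ y, 0 ≤ f₁ y) (h₂ : ∀ y, 0 ≤ f₂ y)
    (hi₁ : Integrable f₁ Q) (hi₂ : Integrable f₂ Q)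
    (hone₁ : ∫ y, f₁ y ∂Q = 1) (hone₂ : ∫ y, f₂ y ∂Q = 1)
    (hi : Integrable (fun y => √(f₁ y * f₂ y)) Q)
    {S : Set Y} (hS : MeasurableSet S) {ε : ℝ} (hε : 0 < ε) (hε2 : ε < 1 / 2)
    (hS₁ : ∫ y in S, f₁ y ∂Q ≤ ε) (hS₂ : ∫ y in Sᶜ, f₂ y ∂Q ≤ ε) :
    ∫ y, √(f₁ y * f₂ y) ∂Q ≤ √(4 * ε * (1 - ε)) := by
  set c := √(4 * ε * (1 - ε)) with hc
  have hcsq : c ^ 2 = 4 * ε * (1 - ε) := Real.sq_sqrt (by nlinarith)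
  have hcpos : 0 < c := Real.sqrt_pos.2 (by nlinarith)
  have key (u v a b : ℝ) (hu : 0 ≤ u) (hv : 0 ≤ v) (ha : 0 ≤ a) (hb : 0 ≤ b)
      (huv : 4 * u * v = c ^ 2) : c * √(a * b) ≤ u * a + v * b := by
    have : c * √(a * b) = √(c ^ 2 * (a * b)) := by
      rw [Real.sqrt_mul (sq_nonneg c), Real.sqrt_sq hcpos.le]
    rw [this, ← huv]
    apply Real.sqrt_le_iff.2 ⟨by positivity, ?_⟩
    nlinarith [sq_nonneg (u * a - v * b)]
  have hA : ∫ y in S, c * √(f₁ y * f₂ y) ∂Q ≤ ∫ y in S, ((1 - ε) * f₁ y + ε * f₂ y) ∂Q :=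
    integral_mono (hi.const_mul c).integrableOn
      ((hi₁.const_mul _).add (hi₂.const_mul _)).integrableOn
      fun y => key _ _ _ _ (by linarith) hε.le (h₁ y) (h₂ y) (by rw [hcsq]; ring)
  have hB : ∫ y in Sᶜ, c * √(f₁ y * f₂ y) ∂Q ≤ ∫ y in Sᶜ, (ε * f₁ y + (1 - ε) * f₂ y) ∂Q :=
    integral_mono (hi.const_mul c).integrableOn
      ((hi₁.const_mul _).add (hi₂.const_mul _)).integrableOn
      fun y => key _ _ _ _ hε.le (by linarith) (h₁ y) (h₂ y) hcsq.symm
  rw [integral_add (hi₁.const_mul _).integrableOn (hi₂.const_mul _).integrableOn] at hA hB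
  have e₁ := integral_add_compl hS hi₁
  have e₂ := integral_add_compl hS hi₂
  have e := integral_add_compl hS (hi.const_mul c)
  simp only [integral_const_mul] at hA hB e
  rw [hone₁] at e₁
  rw [hone₂] at e₂
  refine le_of_mul_le_mul_left ?_ hcpos
  rw [← sq, hcsq, ← e]
  nlinarith [mul_nonneg (sub_nonneg.2 hS₁) (by linarith : (0:ℝ) ≤ 1 - 2 * ε),
    mul_nonneg (sub_nonneg.2 hS₂) (by linarith : (0:ℝ) ≤ 1 - 2 * ε)]

namespace GoodOS

variable {Ω : Type} [TopologicalSpace Ω] [PolishSpace Ω] [MeasurableSpace Ω] [BorelSpace Ω]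
  {m : ℕ} (O : GoodOS Ω m) {μ ν : Fin m → ℝ}

theorem continuous_p (hμ : μ ∈ O.M) : Continuous (O.p μ) :=
  O.p_cont.comp_continuous (f := fun ω => (μ, ω)) (by fun_prop) fun _ => ⟨hμ, trivial⟩

theorem integrable_p (hμ : μ ∈ O.M) : Integrable (O.p μ) O.P :=
  .of_integral_ne_zero (by simp [O.p_prob μ hμ])

theorem continuousOn_Phi {φ : Ω → ℝ} (hφ : φ ∈ O.F) : ContinuousOn (O.Phi φ) O.M :=
  (O.mgf_concave φ hφ).continuousOn_of_relativelyOpen O.M_relatively_open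

theorem Phi_sum_le {J : Type*} (s : Finset J) (w : J → ℝ) (φ : J → Ω → ℝ)
    (hw : ∀ j ∈ s, 0 ≤ w j) (hsum : ∑ j ∈ s, w j = 1) (hφ : ∀ j ∈ s, φ j ∈ O.F)
    (hμ : μ ∈ O.M) : O.Phi (∑ j ∈ s, w j • φ j) μ ≤ ∑ j ∈ s, w j * O.Phi (φ j) μ := by
  set c := ∑ j ∈ s, w j * O.Phi (φ j) μ with hc
  have hmem : ∑ j ∈ s, w j • φ j ∈ O.F := O.F.sum_mem fun j hj => O.F.smul_mem _ (hφ j hj)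
  have hpoint (ω : Ω) : Real.exp ((∑ j ∈ s, w j • φ j) ω) * O.p μ ω ≤
      Real.exp c * ∑ j ∈ s, w j * Real.exp (-O.Phi (φ j) μ) *
        (Real.exp (φ j ω) * O.p μ ω) := by
    have h := convexOn_exp.map_sum_le hw hsum
      (p := fun j => φ j ω - O.Phi (φ j) μ) fun _ _ => Set.mem_univ _
    have e : (∑ j ∈ s, w j • φ j) ω = c + ∑ j ∈ s, w j • (φ j ω - O.Phi (φ j) μ) := by
      simp [hc, mul_sub]
    rw [e, Real.exp_add, mul_assoc]
    refine mul_le_mul_of_nonneg_left ?_ (Real.exp_pos _).le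
    refine (mul_le_mul_of_nonneg_right h (O.p_pos μ hμ ω).le).trans_eq ?_
    rw [Finset.sum_mul]
    refine Finset.sum_congr rfl fun j _ => ?_
    rw [smul_eq_mul, sub_eq_add_neg, Real.exp_add]
    ring
  have hterm_int (j) (hj : j ∈ s) : Integrable (fun ω => w j * Real.exp (-O.Phi (φ j) μ) *
        (Real.exp (φ j ω) * O.p μ ω)) O.P := (O.mgf_integrable _ (hφ j hj) μ hμ).const_mul _
  have h := integral_mono (O.mgf_integrable _ hmem μ hμ)
    ((integrable_finsetSum s hterm_int).const_mul (Real.exp c)) hpoint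
  rw [integral_const_mul, integral_finsetSum s hterm_int] at h
  have hone : ∑ j ∈ s, ∫ ω, w j * Real.exp (-O.Phi (φ j) μ) *
      (Real.exp (φ j ω) * O.p μ ω) ∂O.P = 1 := by
    rw [← hsum]
    refine Finset.sum_congr rfl fun j hj => ?_
    have hpos := O.mgf_pos _ (hφ j hj) μ hμ
    rw [integral_const_mul, Phi, Real.exp_neg, Real.exp_log hpos, mul_assoc,
      inv_mul_cancel₀ hpos.ne', mul_one]
  rw [hone, mul_one] at h
  exact (Real.log_le_iff_le_exp (O.mgf_pos _ hmem μ hμ)).2 h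

/-- The Hellinger affinity of `p_μ` and `p_ν`. -/
noncomputable def affinity (μ ν : Fin m → ℝ) : ℝ := ∫ ω, √(O.p μ ω * O.p ν ω) ∂O.P

/-- Half the log-likelihood ratio of `p_ν` against `p_μ`. -/
noncomputable def halfLogRatio (μ ν : Fin m → ℝ) : Ω → ℝ :=
  (-(1 / 2 : ℝ)) • fun ω => Real.log (O.p μ ω / O.p ν ω)

theorem halfLogRatio_mem (hμ : μ ∈ O.M) (hν : ν ∈ O.M) : O.halfLogRatio μ ν ∈ O.F :=
  O.F.smul_mem _ (O.F_logratio μ hμ ν hν)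

theorem exp_halfLogRatio_mul (hμ : μ ∈ O.M) (hν : ν ∈ O.M) (ω : Ω) :
    Real.exp (O.halfLogRatio μ ν ω) * O.p μ ω = √(O.p μ ω * O.p ν ω) := by
  have h₁ := O.p_pos μ hμ ω
  have h₂ := O.p_pos ν hν ω
  rw [Real.sqrt_eq_rpow, Real.rpow_def_of_pos (mul_pos h₁ h₂)]
  conv_lhs => rw [← Real.exp_log h₁]
  rw [← Real.exp_add, Real.log_mul h₁.ne' h₂.ne']
  simp only [halfLogRatio, Pi.smul_apply, smul_eq_mul, Real.log_div h₁.ne' h₂.ne']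
  ring_nf

theorem neg_halfLogRatio (hμ : μ ∈ O.M) (hν : ν ∈ O.M) :
    -O.halfLogRatio μ ν = O.halfLogRatio ν μ := by
  ext ω
  simp only [halfLogRatio, Pi.neg_apply, Pi.smul_apply, smul_eq_mul,
    Real.log_div (O.p_pos μ hμ ω).ne' (O.p_pos ν hν ω).ne',
    Real.log_div (O.p_pos ν hν ω).ne' (O.p_pos μ hμ ω).ne']
  ring

theorem Phi_halfLogRatio (hμ : μ ∈ O.M) (hν : ν ∈ O.M) :
    O.Phi (O.halfLogRatio μ ν) μ = Real.log (O.affinity μ ν) := by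
  simp only [Phi, affinity, O.exp_halfLogRatio_mul hμ hν]

theorem affinity_comm : O.affinity μ ν = O.affinity ν μ := by simp only [affinity, mul_comm]

theorem integrable_sqrt (hμ : μ ∈ O.M) (hν : ν ∈ O.M) :
    Integrable (fun ω => √(O.p μ ω * O.p ν ω)) O.P := by
  simpa only [O.exp_halfLogRatio_mul hμ hν] using
    O.mgf_integrable _ (O.halfLogRatio_mem hμ hν) μ hμ

theorem affinity_pos (hμ : μ ∈ O.M) (hν : ν ∈ O.M) : 0 < O.affinity μ ν := by
  simpa only [affinity, O.exp_halfLogRatio_mul hμ hν] using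
    O.mgf_pos _ (O.halfLogRatio_mem hμ hν) μ hμ

theorem integrable_prod_p (hμ : μ ∈ O.M) (N : ℕ) :
    Integrable (fun y : Fin N → Ω => ∏ k, O.p μ (y k)) (Measure.pi fun _ => O.P) :=
  have := O.sigmaFinite
  .fintype_prod fun _ => O.integrable_p hμ

theorem integral_prod_p (hμ : μ ∈ O.M) (N : ℕ) :
    ∫ y : Fin N → Ω, ∏ k, O.p μ (y k) ∂Measure.pi (fun _ => O.P) = 1 := by
  have := O.sigmaFinite
  rw [integral_fintype_prod_eq_pow, O.p_prob μ hμ, one_pow]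

theorem prodDensityMeasure_apply (hμ : μ ∈ O.M) (N : ℕ) {S : Set (Fin N → Ω)}
    (hS : MeasurableSet S) :
    prodDensityMeasure O.P N (O.p μ) S =
      ENNReal.ofReal (∫ y in S, ∏ k, O.p μ (y k) ∂Measure.pi fun _ => O.P) := by
  rw [prodDensityMeasure, withDensity_apply _ hS,
    ofReal_integral_eq_lintegral_ofReal (O.integrable_prod_p hμ N).integrableOn]
  exact .of_forall fun y => Finset.prod_nonneg fun k _ => (O.p_pos μ hμ _).le

theorem affinity_pow_le (hμ : μ ∈ O.M) (hν : ν ∈ O.M) {N : ℕ} {S : Set (Fin N → Ω)}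
    (hS : MeasurableSet S) {ε : ℝ} (hε : 0 < ε) (hε2 : ε < 1 / 2)
    (hS₁ : prodDensityMeasure O.P N (O.p μ) S ≤ ENNReal.ofReal ε)
    (hS₂ : prodDensityMeasure O.P N (O.p ν) Sᶜ ≤ ENNReal.ofReal ε) :
    O.affinity μ ν ^ N ≤ √(4 * ε * (1 - ε)) := by
  have := O.sigmaFinite
  rw [O.prodDensityMeasure_apply hμ N hS, ENNReal.ofReal_le_ofReal_iff hε.le] at hS₁
  rw [O.prodDensityMeasure_apply hν N hS.compl, ENNReal.ofReal_le_ofReal_iff hε.le] at hS₂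
  have hprod (y : Fin N → Ω) : √((∏ k, O.p μ (y k)) * ∏ k, O.p ν (y k)) =
      ∏ k, √(O.p μ (y k) * O.p ν (y k)) := by
    rw [← Finset.prod_mul_distrib, Real.sqrt_prod _ fun k _ =>
      (mul_pos (O.p_pos μ hμ _) (O.p_pos ν hν _)).le]
  have hnonneg {κ : Fin m → ℝ} (hκ : κ ∈ O.M) (y : Fin N → Ω) : 0 ≤ ∏ k, O.p κ (y k) :=
    Finset.prod_nonneg fun k _ => (O.p_pos κ hκ _).le
  have h := integral_sqrt_mul_le_of_test (hnonneg hμ) (hnonneg hν) (O.integrable_prod_p hμ N)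
    (O.integrable_prod_p hν N) (O.integral_prod_p hμ N) (O.integral_prod_p hν N)
    (by simp only [hprod]; exact .fintype_prod fun _ => O.integrable_sqrt hμ hν)
    hS hε hε2 hS₁ hS₂
  simp only [hprod] at h
  rwa [integral_fintype_prod_eq_pow (fun ω => √(O.p μ ω * O.p ν ω)), Fintype.card_fin] at h

end GoodOS

section LinearProblem

variable {Ω : Type} [TopologicalSpace Ω] [PolishSpace Ω] [MeasurableSpace Ω]
  [BorelSpace Ω] {m n : ℕ} {ι : Type}
  {O : GoodOS Ω m} {X : ι → Set (Fin n → ℝ)}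
  {A : ι → (Fin n → ℝ) →ᵃ[ℝ] (Fin m → ℝ)} {g : Fin n → ℝ} {ε : ℝ} {K : ℕ}

theorem PsiPlus_add_PsiMinus_le [Fintype ι] {i j : ι} (hi : (X i).Nonempty) (hj : (X j).Nonempty)
    {β : ℝ} {ψ : Ω → ℝ} {c : ℝ}
    (h : ∀ x ∈ X i, ∀ y ∈ X j, (K : ℝ) * β * (O.Phi (fun ω => ψ ω / β) (A i x) +
      O.Phi (fun ω => -ψ ω / β) (A j y)) + (g ⬝ᵥ y - g ⬝ᵥ x) +
      2 * (β * Real.log (2 * (Fintype.card ι : ℝ) / ε)) ≤ c) :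
    PsiPlus O X A g ε K i β ψ + PsiMinus O X A g ε K j β ψ ≤ c := by
  obtain ⟨x₀, hx₀⟩ := hi
  obtain ⟨y₀, hy₀⟩ := hj
  rw [← le_sub_iff_add_le]
  refine csSup_le ⟨_, x₀, hx₀, rfl⟩ ?_
  rintro _ ⟨x, hx, rfl⟩
  rw [le_sub_comm]
  refine csSup_le ⟨_, y₀, hy₀, rfl⟩ ?_
  rintro _ ⟨y, hy, rfl⟩
  have := h x hx y hy
  simp only [dotProduct] at this
  linarith

/-- If the affinity at every pair of signals whose functional values are more than `2ρ` apart
is small enough, then `Opt_{ij}(K) ≤ ρ`. -/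
theorem OptIJ_le_of_affinity [Fintype ι] (hXne : ∀ j, (X j).Nonempty) (hXconv : ∀ j, Convex ℝ (X j))
    (hXcomp : ∀ j, IsCompact (X j)) (hA : ∀ j, ∀ x ∈ X j, A j x ∈ O.M) {i j : ι} {ρ : ℝ}
    (hρ : 0 ≤ ρ)
    (hsep : ∀ x ∈ X i, ∀ y ∈ X j, 2 * ρ < g ⬝ᵥ y - g ⬝ᵥ x →
      K * Real.log (O.affinity (A i x) (A j y)) +
        Real.log (2 * (Fintype.card ι : ℝ) / ε) < 0) :
    OptIJ O X A g ε K i j ≤ ρ := by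
  set L := Real.log (2 * (Fintype.card ι : ℝ) / ε) with hL
  refine le_of_forall_pos_le_add fun δ hδ => ?_
  let J := {q : ℝ × (Ω → ℝ) // 0 < q.1 ∧ q.2 ∈ O.F}
  let f : J → (Fin n → ℝ) × (Fin n → ℝ) → ℝ := fun q z =>
    (K : ℝ) * q.1.1 * (O.Phi q.1.2 (A i z.1) + O.Phi (-q.1.2) (A j z.2)) +
      (g ⬝ᵥ z.2 - g ⬝ᵥ z.1) + 2 * (q.1.1 * L)
  have hconv : Convex ℝ (X i ×ˢ X j) := (hXconv i).prod (hXconv j)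
  have hconc (q : J) : ConcaveOn ℝ (X i ×ˢ X j) (f q) := by
    refine ⟨hconv, fun z hz z' hz' a b ha hb hab => ?_⟩
    have h₁ := (O.mgf_concave _ q.2.2).2 (hA i _ hz.1) (hA i _ hz'.1) ha hb hab
    have h₂ := (O.mgf_concave _ (O.F.neg_mem q.2.2)).2 (hA j _ hz.2) (hA j _ hz'.2) ha hb hab
    rw [← Convex.combo_affine_apply hab] at h₁ h₂
    have hα : 0 ≤ (K : ℝ) * q.1.1 := mul_nonneg K.cast_nonneg q.2.1.le
    have h := mul_le_mul_of_nonneg_left (add_le_add h₁ h₂) hα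
    simp only [f, GoodOS.Phi, Prod.fst_add, Prod.snd_add, Prod.smul_fst, Prod.smul_snd,
      dotProduct_add, dotProduct_smul, smul_eq_mul] at h ⊢
    have hb' : b = 1 - a := by linarith
    subst hb'
    linarith
  have hcont (q : J) : ContinuousOn (f q) (X i ×ˢ X j) := by
    have h₁ : ContinuousOn (fun z : (Fin n → ℝ) × (Fin n → ℝ) => O.Phi q.1.2 (A i z.1))
        (X i ×ˢ X j) := (O.continuousOn_Phi q.2.2).comp
      ((A i).continuous_of_finiteDimensional.comp continuous_fst).continuousOn
      fun z hz => hA i _ hz.1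
    have h₂ : ContinuousOn (fun z : (Fin n → ℝ) × (Fin n → ℝ) => O.Phi (-q.1.2) (A j z.2))
        (X i ×ˢ X j) := (O.continuousOn_Phi (O.F.neg_mem q.2.2)).comp
      ((A j).continuous_of_finiteDimensional.comp continuous_snd).continuousOn
      fun z hz => hA j _ hz.2
    have h₃ : Continuous fun z : (Fin n → ℝ) × (Fin n → ℝ) => g ⬝ᵥ z.2 - g ⬝ᵥ z.1 := by
      unfold dotProduct
      fun_prop
    exact ((continuousOn_const.mul (h₁.add h₂)).add h₃.continuousOn).add continuousOn_const
  have hlt : ∀ z ∈ X i ×ˢ X j, ∃ q, f q z < 2 * (ρ + δ) := by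
    rintro ⟨x, y⟩ ⟨hx, hy⟩
    have hμ := hA i x hx
    have hν := hA j y hy
    have hmem := O.halfLogRatio_mem hμ hν
    set D := K * Real.log (O.affinity (A i x) (A j y)) + L with hD
    have hval (α : ℝ) (hα : 0 < α) : f ⟨(α, O.halfLogRatio (A i x) (A j y)), hα, hmem⟩ (x, y) =
        (g ⬝ᵥ y - g ⬝ᵥ x) + 2 * (α * D) := by
      simp only [f, O.neg_halfLogRatio hμ hν, O.Phi_halfLogRatio hμ hν,
        O.Phi_halfLogRatio hν hμ, O.affinity_comm (μ := A j y), hD]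
      ring
    obtain ⟨α, hα, h⟩ : ∃ α : ℝ, 0 < α ∧ (g ⬝ᵥ y - g ⬝ᵥ x) + 2 * (α * D) < 2 * (ρ + δ) := by
      rcases lt_or_ge (2 * ρ) (g ⬝ᵥ y - g ⬝ᵥ x) with hgap | hgap
      · have hneg : 0 < -D := by linarith [hsep x hx y hy hgap]
        refine ⟨(g ⬝ᵥ y - g ⬝ᵥ x) / -D, div_pos (by linarith) hneg, ?_⟩
        have : (g ⬝ᵥ y - g ⬝ᵥ x) / -D * D = -(g ⬝ᵥ y - g ⬝ᵥ x) := by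
          field_simp [show D ≠ 0 by linarith]
        rw [this]
        linarith
      · refine ⟨δ / (|D| + 1), by positivity, ?_⟩
        have : δ / (|D| + 1) * D < δ := by
          rw [div_mul_eq_mul_div, div_lt_iff₀ (by positivity)]
          nlinarith [le_abs_self D]
        linarith
    exact ⟨_, (hval α hα).trans_lt h⟩
  obtain ⟨s, w, hw, hsum, hs⟩ := exists_convexCombination_lt ((hXne i).prod (hXne j))
    ((hXcomp i).prod (hXcomp j)) hconv f _ hconc hcont hlt
  set α := ∑ q, w q * q.1.1.1 with hα
  have hterm (q : s) : 0 ≤ w q * q.1.1.1 := mul_nonneg (hw q) q.1.2.1.le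
  have hαpos : 0 < α := by
    refine (Finset.sum_nonneg fun q _ => hterm q).lt_of_ne' fun h0 => ?_
    rw [Finset.sum_eq_zero_iff_of_nonneg fun q _ => hterm q] at h0
    have : ∑ q, w q = 0 := Finset.sum_eq_zero fun q hq =>
      (mul_eq_zero.1 (h0 q hq)).resolve_right q.1.2.1.ne'
    linarith
  let v : s → ℝ := fun q => w q * q.1.1.1 / α
  have hv (q : s) : 0 ≤ v q := div_nonneg (hterm q) hαpos.le
  have hvsum : ∑ q, v q = 1 := by rw [← Finset.sum_div, ← hα, div_self hαpos.ne']
  have hαv (q : s) : α * v q = w q * q.1.1.1 := mul_div_cancel₀ _ hαpos.ne'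
  set φ : Ω → ℝ := ∑ q, v q • q.1.1.2 with hφ
  have hφF : φ ∈ O.F := O.F.sum_mem fun q _ => O.F.smul_mem _ q.1.2.2
  have hneg : -φ = ∑ q, v q • -q.1.1.2 := by simp [hφ]
  have hle : PsiPlus O X A g ε K i α (α • φ) + PsiMinus O X A g ε K j α (α • φ) ≤
      2 * (ρ + δ) := by
    refine PsiPlus_add_PsiMinus_le (hXne i) (hXne j) fun x hx y hy => ?_
    have e₁ : (fun ω => (α • φ) ω / α) = φ := by
      ext ω; simp [mul_div_cancel_left₀ _ hαpos.ne']
    have e₂ : (fun ω => -(α • φ) ω / α) = -φ := by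
      ext ω; simp [neg_div, mul_div_cancel_left₀ _ hαpos.ne']
    rw [e₁, e₂, ← hL]
    refine le_trans ?_ (hs (x, y) ⟨hx, hy⟩).le
    have h₁ := O.Phi_sum_le Finset.univ v (fun q => q.1.1.2) (fun q _ => hv q) hvsum
      (fun q _ => q.1.2.2) (hA i x hx)
    have h₂ := O.Phi_sum_le Finset.univ v (fun q => -q.1.1.2) (fun q _ => hv q) hvsum
      (fun q _ => O.F.neg_mem q.1.2.2) (hA j y hy)
    rw [← hφ] at h₁
    rw [← hneg] at h₂
    have h := mul_le_mul_of_nonneg_left (add_le_add h₁ h₂)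
      (mul_nonneg (K.cast_nonneg (α := ℝ)) hαpos.le)
    have e : ∑ q, w q * f q (x, y) =
        K * α * (∑ q, v q * O.Phi q.1.1.2 (A i x) + ∑ q, v q * O.Phi (-q.1.1.2) (A j y)) +
          (g ⬝ᵥ y - g ⬝ᵥ x) + 2 * (α * L) := by
      calc ∑ q, w q * f q (x, y)
          = ∑ q, ((K * (α * v q) * O.Phi q.1.1.2 (A i x) +
              K * (α * v q) * O.Phi (-q.1.1.2) (A j y)) +
              w q * (g ⬝ᵥ y - g ⬝ᵥ x) + (w q * q.1.1.1) * (2 * L)) :=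
            Finset.sum_congr rfl fun q _ => by simp only [hαv, f]; ring
        _ = _ := by
            rw [Finset.sum_add_distrib, Finset.sum_add_distrib, Finset.sum_add_distrib,
              ← Finset.sum_mul, ← Finset.sum_mul, ← hα, hsum, one_mul]
            simp only [mul_add, Finset.mul_sum, mul_assoc]
            ring
    rw [e]
    linarith
  rw [OptIJ]
  by_cases hbdd : BddBelow {v | ∃ α : ℝ, 0 < α ∧ ∃ φ ∈ O.F,
    v = (1 / 2) * (PsiPlus O X A g ε K i α φ + PsiMinus O X A g ε K j α φ)}
  · exact (csInf_le hbdd ⟨α, hαpos, α • φ, O.F.smul_mem _ hφF, rfl⟩).trans (by linarith)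
  · rw [Real.sInf_of_not_bddBelow hbdd]
    positivity

theorem affinity_pow_le_of_reliable (hA : ∀ j, ∀ x ∈ X j, A j x ∈ O.M) (hε : 0 < ε)
    (hε2 : ε < 1 / 2) {N : ℕ} {ghat : (Fin N → Ω) → ℝ} (hmeas : Measurable ghat) {ρ : ℝ}
    (hrel : ∀ j : ι, ∀ x ∈ X j, prodDensityMeasure O.P N (O.p (A j x))
      {y | ρ < |ghat y - ∑ i, g i * x i|} ≤ ENNReal.ofReal ε)
    {i j : ι} {x y : Fin n → ℝ} (hx : x ∈ X i) (hy : y ∈ X j)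
    (hgap : 2 * ρ < g ⬝ᵥ y - g ⬝ᵥ x) :
    O.affinity (A i x) (A j y) ^ N ≤ √(4 * ε * (1 - ε)) := by
  refine O.affinity_pow_le (hA i x hx) (hA j y hy)
    (S := {z | (g ⬝ᵥ x + g ⬝ᵥ y) / 2 ≤ ghat z}) (measurableSet_le measurable_const hmeas) hε hε2
    ((measure_mono fun z hz => ?_).trans (hrel i x hx))
    ((measure_mono fun z hz => ?_).trans (hrel j y hy))
  · change ρ < |ghat z - g ⬝ᵥ x|
    have : (g ⬝ᵥ x + g ⬝ᵥ y) / 2 ≤ ghat z := hz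
    exact lt_of_lt_of_le (by linarith) (le_abs_self _)
  · change ρ < |ghat z - g ⬝ᵥ y|
    have : ghat z < (g ⬝ᵥ x + g ⬝ᵥ y) / 2 := not_le.1 hz
    exact lt_of_lt_of_le (by linarith) (neg_le_abs _)

theorem nonneg_of_reliable [Nonempty ι] (hXne : ∀ j, (X j).Nonempty) (hA : ∀ j, ∀ x ∈ X j, A j x ∈ O.M)
    (hε2 : ε < 1 / 2) {N : ℕ} {ghat : (Fin N → Ω) → ℝ} {ρ : ℝ}
    (hrel : ∀ j : ι, ∀ x ∈ X j, prodDensityMeasure O.P N (O.p (A j x))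
      {y | ρ < |ghat y - ∑ i, g i * x i|} ≤ ENNReal.ofReal ε) : 0 ≤ ρ := by
  by_contra! hneg
  obtain ⟨j⟩ := ‹Nonempty ι›
  obtain ⟨x, hx⟩ := hXne j
  have h := hrel j x hx
  rw [Set.eq_univ_of_forall (s := {y | ρ < |ghat y - ∑ i, g i * x i|})
    fun y => hneg.trans_le (abs_nonneg _),
    O.prodDensityMeasure_apply (hA j x hx) N .univ, Measure.restrict_univ,
    O.integral_prod_p (hA j x hx), ENNReal.ofReal_le_ofReal_iff'] at h
  rcases h with h | h <;> linarith

theorem exists_reliable [Fintype ι] (hXcomp : ∀ j, IsCompact (X j)) (N : ℕ) :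
    ∃ ρ : ℝ, ∃ ghat : (Fin N → Ω) → ℝ, Measurable ghat ∧
      ∀ j : ι, ∀ x ∈ X j, prodDensityMeasure O.P N (O.p (A j x))
        {y | ρ < |ghat y - ∑ i, g i * x i|} ≤ ENNReal.ofReal ε := by
  have hcont : Continuous fun x : Fin n → ℝ => ∑ i, g i * x i := by fun_prop
  obtain ⟨ρ, hρ⟩ := (isCompact_iUnion hXcomp).exists_bound_of_continuousOn hcont.continuousOn
  refine ⟨ρ, fun _ => 0, measurable_const, fun j x hx => ?_⟩
  have hx' : |∑ i, g i * x i| ≤ ρ := hρ x (Set.mem_iUnion_of_mem j hx)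
  simp [hx'.not_gt]

end LinearProblem

theorem mul_log_add_lt_zero_of_pow_le {h L δ : ℝ} {K N : ℕ} (hh : 0 < h) (hN : 0 < N)
    (hδ : 0 < δ) (hδ1 : δ < 1) (hpow : h ^ N ≤ √δ)
    (hK : (K : ℝ) > 2 * L * N / Real.log (1 / δ)) : K * Real.log h + L < 0 := by
  have hD : 0 < Real.log (1 / δ) := Real.log_pos (by rw [lt_div_iff₀ hδ]; linarith)
  have h₁ := Real.log_le_log (pow_pos hh N) hpow
  rw [Real.log_pow, Real.log_sqrt hδ.le] at h₁
  rw [gt_iff_lt, div_lt_iff₀ hD] at hK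
  rw [one_div, Real.log_inv] at hK hD
  have hN' : (0 : ℝ) < N := by exact_mod_cast hN
  have h₂ := mul_le_mul_of_nonneg_left h₁ (K.cast_nonneg (α := ℝ))
  by_contra! hcon
  have := mul_nonneg hcon hN'.le
  nlinarith

/-- **Proposition 2, part (i).** In a good observation scheme, for the
linear-form recovery problem, for every `ε ∈ (0,1/2)`, every positive integer `K̄` and
every integer `K > 2 ln(2I/ε) K̄ / ln(1/(4ε(1−ε)))`, one has `Opt(K) ≤ Risk*_ε(K̄)`. -/
theorem opt_le_minimax_risk {Ω : Type} [TopologicalSpace Ω] [PolishSpace Ω]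
    [MeasurableSpace Ω] [BorelSpace Ω] {m n : ℕ} {ι : Type} [Fintype ι] [Nonempty ι]
    (O : GoodOS Ω m)
    (X : ι → Set (Fin n → ℝ))
    (hXne : ∀ j, (X j).Nonempty) (hXconv : ∀ j, Convex ℝ (X j))
    (hXcomp : ∀ j, IsCompact (X j))
    (A : ι → (Fin n → ℝ) →ᵃ[ℝ] (Fin m → ℝ)) (hA : ∀ j, ∀ x ∈ X j, A j x ∈ O.M)
    (g : Fin n → ℝ)
    (ε : ℝ) (hε : 0 < ε) (hε2 : ε < 1 / 2)
    (Kb : ℕ) (hKb : 0 < Kb) (K : ℕ)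
    (hK : (K : ℝ) > 2 * Real.log (2 * (Fintype.card ι : ℝ) / ε) * (Kb : ℝ) /
      Real.log (1 / (4 * ε * (1 - ε)))) :
    OptTotal O X A g ε K ≤ RiskStar O X A g ε Kb := by
  refine le_csInf (exists_reliable hXcomp Kb) ?_
  rintro ρ ⟨ghat, hmeas, hrel⟩
  refine Finset.sup'_le _ _ fun q _ => OptIJ_le_of_affinity hXne hXconv hXcomp hA
    (nonneg_of_reliable hXne hA hε2 hrel) fun x hx y hy hgap => ?_
  exact mul_log_add_lt_zero_of_pow_le (O.affinity_pos (hA _ x hx) (hA _ y hy)) hKb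
    (by nlinarith) (by nlinarith [sq_pos_of_pos (sub_pos.2 hε2)])
    (affinity_pow_le_of_reliable hA hε hε2 hmeas hrel hx hy hgap) hK
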